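/- The number of arrowed one-vertex planar graphs of degree 2m equals the m-th Catalan number: for every m ≥ 1, the number of fixed-point-free involutions α of ℤ/2mℤ such that the permutation x ↦ α(x)+1 of ℤ/2mℤ has exactly m+1 cycles is equal to catalan m. (In the notation of cellular graph counts, C_{0,1}(2m) = C_m.) -/

import Mathlib

/-- The number of cycles of a permutation `π` of a finite set, i.e. the number of orbits
of the cyclic group generated by `π` (fixed points count as 1-cycles). -/
noncomputable def cycleCount {β : Type} [Fintype β] (π : Equiv.Perm β) : ℕ :=
  Nat.card (Quotient (MulAction.orbitRel (Subgroup.zpowers π) β))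

set_option linter.unusedSectionVars false

open Equiv Finset

section aux
variable {X : Type} [Fintype X] [DecidableEq X]

/-- `κ` is a colouring whose classes are exactly the cycles of `π`. -/
def Classifies (π : Perm X) (κ : X → ℕ) : Prop := ∀ x y, π.SameCycle x y ↔ κ x = κ y

lemma cycleCount_eq_image {π : Perm X} {κ : X → ℕ} (h : Classifies π κ) :
    cycleCount π = (univ.image κ).card := by
  have e : ∀ x y, (MulAction.orbitRel (Subgroup.zpowers π) X) x y ↔ κ x = κ y := by
    intro x y
    rw [← h, MulAction.orbitRel_apply, MulAction.mem_orbit_iff]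
    constructor
    · rintro ⟨⟨g, i, rfl⟩, hg⟩
      exact Perm.SameCycle.symm ⟨i, hg⟩
    · intro hs
      obtain ⟨i, hi⟩ := hs.symm
      exact ⟨⟨π ^ i, i, rfl⟩, hi⟩
  unfold cycleCount
  have : (univ.image κ).card = Nat.card (Set.range κ) := by
    rw [← Nat.card_eq_card_toFinset (Set.range κ) |>.symm |> fun h => h]
    congr 1
    ext; simp
  rw [this]
  refine Nat.card_congr (Equiv.ofBijective
    (Quotient.lift (fun x => (⟨κ x, x, rfl⟩ : Set.range κ)) ?_) ⟨?_, ?_⟩)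
  · intro x y hxy
    exact Subtype.ext ((e x y).1 hxy)
  · intro p q
    induction p using Quotient.inductionOn
    induction q using Quotient.inductionOn
    intro hpq
    exact Quotient.sound ((e _ _).2 (congrArg Subtype.val hpq))
  · rintro ⟨_, x, rfl⟩
    exact ⟨Quotient.mk _ x, rfl⟩

lemma exists_classifies (π : Perm X) : ∃ κ : X → ℕ, ∃ N, Classifies π κ ∧ ∀ x, κ x < N := by
  classical
  let s := Perm.SameCycle.setoid π
  let e := Fintype.equivFin (Quotient s)
  refine ⟨fun x => e (Quotient.mk s x), Fintype.card (Quotient s), ?_, fun x => (e _).2⟩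
  intro x y
  rw [Fin.val_inj, e.apply_eq_iff_eq, Quotient.eq]
  rfl

lemma pow_inj {π : Perm X} {a : X} {i j : ℕ} (hi : 0 < i) (hj : 0 < j)
    (hi' : i ≤ Function.minimalPeriod π a) (hj' : j ≤ Function.minimalPeriod π a)
    (h : (π ^ i) a = (π ^ j) a) : i = j := by
  have h1 : ((π ^ (i-1)) a) = ((π ^ (j-1)) a) := by
    apply π.injective
    rw [← Perm.mul_apply, ← Perm.mul_apply, ← pow_succ', ← pow_succ']
    rwa [Nat.sub_add_cancel hi, Nat.sub_add_cancel hj]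
  have := (Function.iterate_eq_iterate_iff_of_lt_minimalPeriod (f := π) (x := a)
    (m := i-1) (n := j-1) (by omega) (by omega)).1 (by
      rw [Perm.iterate_eq_pow, Perm.iterate_eq_pow]; exact h1)
  omega

lemma minPer_pos (π : Perm X) (a : X) : 0 < Function.minimalPeriod π a := by
  apply Function.minimalPeriod_pos_of_mem_periodicPts
  exact Function.Injective.mem_periodicPts π.injective a

lemma pow_minPer (π : Perm X) (a : X) : (π ^ Function.minimalPeriod π a) a = a := by
  rw [← Perm.iterate_eq_pow]
  exact Function.iterate_minimalPeriod

lemma exists_idx {π : Perm X} {a x : X} (h : π.SameCycle a x) :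
    ∃ i, 0 < i ∧ i ≤ Function.minimalPeriod π a ∧ (π ^ i) a = x := by
  obtain ⟨i, hi⟩ := h.exists_nat_pow_eq
  have hp := minPer_pos π a
  have hm := Nat.mod_lt i hp
  have h2 : (π ^ (i % Function.minimalPeriod π a)) a = x := by
    rw [← hi, ← Perm.iterate_eq_pow, ← Perm.iterate_eq_pow]
    exact Function.iterate_mod_minimalPeriod_eq
  rcases Nat.eq_zero_or_pos (i % Function.minimalPeriod π a) with h0 | h0
  · refine ⟨_, hp, le_rfl, ?_⟩
    rw [pow_minPer]
    rw [h0] at h2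
    simpa using h2
  · exact ⟨_, h0, hm.le, h2⟩

lemma swap_run {π : Perm X} {a b y : X} (m : ℕ)
    (h : ∀ i < m, (π ^ i) y ≠ a ∧ (π ^ i) y ≠ b) : ((π * swap a b) ^ m) y = (π ^ m) y := by
  induction m with
  | zero => simp
  | succ m ih =>
    rw [pow_succ', Perm.mul_apply, ih (fun i hi => h i (by omega)), Perm.mul_apply,
      swap_apply_of_ne_of_ne (h m (by omega)).1 (h m (by omega)).2, ← Perm.mul_apply, ← pow_succ']

/-- The colouring after splitting. -/
noncomputable def splitCol (π : Perm X) (κ : X → ℕ) (N : ℕ) (a : X) (k : ℕ) : X → ℕ :=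
  open Classical in
  fun x => if ∃ i, 0 < i ∧ i ≤ k ∧ (π ^ i) a = x then N else κ x

lemma sameCycle_pow (π : Perm X) (a : X) (i : ℕ) : π.SameCycle a ((π ^ i) a) := ⟨i, by simp⟩

lemma classifies_split {π : Perm X} {κ : X → ℕ} {N : ℕ} (h : Classifies π κ) (hN : ∀ x, κ x < N)
    {a : X} {k : ℕ} (hk : 0 < k) (hkn : k < Function.minimalPeriod π a) :
    Classifies (π * swap a ((π ^ k) a)) (splitCol π κ N a k) := by
  set n := Function.minimalPeriod π a with hn
  set b := (π ^ k) a with hb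
  set π' := π * swap a b with hπ'
  have ha : (π ^ n) a = a := pow_minPer π a
  have col1 : ∀ i, 0 < i → i ≤ k → splitCol π κ N a k ((π ^ i) a) = N := by
    intro i h1 h2
    unfold splitCol
    rw [if_pos ⟨i, h1, h2, rfl⟩]
  have col2 : ∀ i, k < i → i ≤ n → splitCol π κ N a k ((π ^ i) a) = κ a := by
    intro i h1 h2
    unfold splitCol
    rw [if_neg]
    · exact ((h _ _).1 (sameCycle_pow π a i)).symm
    · rintro ⟨j, hj, hjk, e⟩
      have := pow_inj hj (by omega) (by omega) h2 e
      omega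
  have col3 : ∀ x, ¬ π.SameCycle a x → splitCol π κ N a k x = κ x := by
    intro x hx
    unfold splitCol
    rw [if_neg]
    rintro ⟨j, hj, hjk, e⟩
    exact hx (e ▸ sameCycle_pow π a j)
  have hstep : ∀ i, (π ((π ^ i) a)) = (π ^ (i+1)) a := fun i => by
    rw [pow_succ', Perm.mul_apply]
  have inv : ∀ x, splitCol π κ N a k (π' x) = splitCol π κ N a k x := by
    intro x
    by_cases hx : π.SameCycle a x
    · obtain ⟨i, hi, hin, rfl⟩ := exists_idx hx
      by_cases hik : i = k
      · subst hik
        rw [hπ', Perm.mul_apply, swap_apply_right, col1 _ hi le_rfl]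
        simpa using col1 1 (by omega) (by omega)
      · by_cases hin' : i = n
        · have e : (π ^ i) a = a := by rw [hin']; exact ha
          have e2 : splitCol π κ N a k a = κ a := by
            have := col2 n hkn le_rfl
            rwa [ha] at this
          rw [e, hπ', Perm.mul_apply, swap_apply_left, hb, hstep, e2, col2 _ (by omega) (by omega)]
        · have h1 : (π ^ i) a ≠ a := fun e => hin' (pow_inj hi (by omega) hin le_rfl (e.trans ha.symm))
          have h2 : (π ^ i) a ≠ b := fun e => hik (pow_inj hi (by omega) hin (by omega) e)
          rw [hπ', Perm.mul_apply, swap_apply_of_ne_of_ne h1 h2, hstep]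
          by_cases hlt : i < k
          · rw [col1 _ (by omega) (by omega), col1 _ (by omega) (by omega)]
          · rw [col2 _ (by omega) (by omega), col2 _ (by omega) (by omega)]
    · have h1 : x ≠ a := fun e => hx (e ▸ Perm.SameCycle.refl _ _)
      have h2 : x ≠ b := fun e => hx (e ▸ sameCycle_pow π a k)
      rw [hπ', Perm.mul_apply, swap_apply_of_ne_of_ne h1 h2, col3 _ hx, col3]
      · exact ((h _ _).1 ⟨1, by simp⟩).symm
      · intro hh
        exact hx (Perm.sameCycle_apply_right.1 hh)
  have same1 : ∀ i, 0 < i → i ≤ k → π'.SameCycle (π a) ((π ^ i) a) := by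
    intro i h1 h2
    have e : ∀ j, (π ^ j) (π a) = (π ^ (j+1)) a := fun j => by rw [pow_succ, Perm.mul_apply]
    have := swap_run (π := π) (a := a) (b := b) (y := π a) (i-1) (by
      intro j hj
      rw [e]
      constructor
      · intro e
        have := pow_inj (by omega) (by omega) (by omega) le_rfl (e.trans ha.symm)
        omega
      · intro e
        have := pow_inj (by omega) (by omega) (by omega) (by omega) e
        omega)
    rw [e, Nat.sub_add_cancel h1] at this
    rw [← this]
    exact sameCycle_pow _ _ _
  have same2 : ∀ i, k < i → i ≤ n → π'.SameCycle ((π ^ (k+1)) a) ((π ^ i) a) := by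
    intro i h1 h2
    have e : ∀ j, (π ^ j) ((π ^ (k+1)) a) = (π ^ (j+(k+1))) a := fun j => by
      rw [pow_add π j, Perm.mul_apply]
    have := swap_run (π := π) (a := a) (b := b) (y := (π ^ (k+1)) a) (i-(k+1)) (by
      intro j hj
      rw [e]
      constructor
      · intro e
        have := pow_inj (by omega) (by omega) (by omega) le_rfl (e.trans ha.symm)
        omega
      · intro e
        have := pow_inj (by omega) (by omega) (by omega) (by omega) e
        omega)
    rw [e, Nat.sub_add_cancel h1] at this
    rw [← this]
    exact sameCycle_pow _ _ _
  have same3 : ∀ x y, ¬ π.SameCycle a x → π.SameCycle x y → π'.SameCycle x y := by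
    intro x y hx hxy
    obtain ⟨i, rfl⟩ := hxy.exists_nat_pow_eq
    have := swap_run (π := π) (a := a) (b := b) (y := x) i (by
      intro j hj
      constructor
      · intro e
        exact hx (Perm.SameCycle.symm (e ▸ sameCycle_pow π x j))
      · intro e
        apply hx
        have h1 := sameCycle_pow π x j
        rw [e] at h1
        exact (sameCycle_pow π a k).trans h1.symm)
    rw [← this]
    exact sameCycle_pow _ _ _
  have inv' : ∀ (j : ℕ) x, splitCol π κ N a k ((π' ^ j) x) = splitCol π κ N a k x := by
    intro j x
    induction j with
    | zero => simp
    | succ j ih => rw [pow_succ', Perm.mul_apply, inv, ih]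
  intro x y
  constructor
  · intro hxy
    obtain ⟨i, rfl⟩ := hxy.exists_nat_pow_eq
    exact (inv' i x).symm
  · intro hc
    by_cases hx : π.SameCycle a x
    · by_cases hy : π.SameCycle a y
      · obtain ⟨i, hi, hin, rfl⟩ := exists_idx hx
        obtain ⟨j, hj, hjn, rfl⟩ := exists_idx hy
        have hNa := hN a
        by_cases hik : i ≤ k <;> by_cases hjk : j ≤ k
        · exact (same1 i hi hik).symm.trans (same1 j hj hjk)
        · rw [col1 i hi hik, col2 j (by omega) hjn] at hc; omega
        · rw [col1 j hj hjk, col2 i (by omega) hin] at hc; omega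
        · exact (same2 i (by omega) hin).symm.trans (same2 j (by omega) hjn)
      · exfalso
        rw [col3 y hy] at hc
        obtain ⟨i, hi, hin, rfl⟩ := exists_idx hx
        by_cases hik : i ≤ k
        · rw [col1 i hi hik] at hc; have := hN y; omega
        · rw [col2 i (by omega) hin] at hc; exact hy ((h _ _).2 hc)
    · by_cases hy : π.SameCycle a y
      · exfalso
        rw [col3 x hx] at hc
        obtain ⟨i, hi, hin, rfl⟩ := exists_idx hy
        by_cases hik : i ≤ k
        · rw [col1 i hi hik] at hc; have := hN x; omega
        · rw [col2 i (by omega) hin] at hc; exact hx ((h _ _).2 hc.symm)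
      · rw [col3 x hx, col3 y hy] at hc
        exact same3 x y hx ((h _ _).2 hc)

lemma exists_idx_lt {π : Perm X} {a b : X} (h : π.SameCycle a b) (hab : a ≠ b) :
    ∃ k, 0 < k ∧ k < Function.minimalPeriod π a ∧ (π ^ k) a = b := by
  obtain ⟨k, h1, h2, h3⟩ := exists_idx h
  refine ⟨k, h1, lt_of_le_of_ne h2 ?_, h3⟩
  rintro rfl
  exact hab ((pow_minPer π a).symm.trans h3)

lemma cycleCount_split {π : Perm X} {a b : X} (h : π.SameCycle a b) (hab : a ≠ b) :
    cycleCount (π * swap a b) = cycleCount π + 1 := by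
  obtain ⟨k, h1, h2, rfl⟩ := exists_idx_lt h hab
  obtain ⟨κ, N, hκ, hN⟩ := exists_classifies π
  rw [cycleCount_eq_image (classifies_split hκ hN h1 h2), cycleCount_eq_image hκ]
  have : univ.image (splitCol π κ N a k) = insert N (univ.image κ) := by
    ext c
    simp only [mem_image, mem_univ, true_and, mem_insert]
    constructor
    · rintro ⟨x, rfl⟩
      unfold splitCol
      split_ifs
      · exact Or.inl rfl
      · exact Or.inr ⟨x, rfl⟩
    · rintro (rfl | ⟨x, rfl⟩)
      · exact ⟨_, if_pos ⟨k, h1, le_rfl, rfl⟩⟩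
      · by_cases hx : ∃ i, 0 < i ∧ i ≤ k ∧ (π ^ i) a = x
        · obtain ⟨i, hi, hik, rfl⟩ := hx
          refine ⟨a, ?_⟩
          unfold splitCol
          rw [if_neg]
          · exact (hκ _ _).1 (sameCycle_pow π a i)
          · rintro ⟨j, hj, hjk, e⟩
            have := pow_inj hj (by omega) (by omega) le_rfl (e.trans (pow_minPer π a).symm)
            omega
        · exact ⟨x, if_neg hx⟩
  rw [this, card_insert_of_notMem]
  simp only [mem_image, mem_univ, true_and, not_exists]
  intro x; exact (hN x).ne

lemma cycleCount_merge {π : Perm X} {a b : X} (h : ¬ π.SameCycle a b) :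
    cycleCount (π * swap a b) + 1 = cycleCount π := by
  have hab : a ≠ b := fun e => h (e ▸ Perm.SameCycle.refl _ _)
  have key : (π * swap a b).SameCycle a b := by
    have hp := minPer_pos π b
    have e : ∀ j, (π ^ j) (π b) = (π ^ (j+1)) b := fun j => by rw [pow_succ, Perm.mul_apply]
    have := swap_run (π := π) (a := a) (b := b) (y := π b) (Function.minimalPeriod π b - 1) (by
      intro j hj
      rw [e]
      constructor
      · intro e
        exact h (Perm.SameCycle.symm (e ▸ sameCycle_pow π b (j+1)))
      · intro e
        have := pow_inj (by omega) (by omega) (by omega) le_rfl (e.trans (pow_minPer π b).symm)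
        omega)
    rw [e, Nat.sub_add_cancel hp, pow_minPer] at this
    have h1 : (π * swap a b) a = π b := by simp
    rw [← h1, ← Perm.mul_apply, ← pow_succ] at this
    have h2 := sameCycle_pow (π * swap a b) a (Function.minimalPeriod π b - 1 + 1)
    rwa [this] at h2
  have := cycleCount_split key hab
  rw [mul_assoc, swap_mul_self, mul_one] at this
  exact this.symm

lemma support_swap_mul {α : Perm X} (h : α * α = 1) {x : X} (hx : α x ≠ x) :
    (swap x (α x) * α) * (swap x (α x) * α) = 1 ∧
    (swap x (α x) * α).support = (α.support.erase x).erase (α x) := by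
  have hh : ∀ y, α (α y) = y := fun y => by rw [← Perm.mul_apply, h]; rfl
  have val : ∀ y, (swap x (α x) * α) y = if y = x ∨ y = α x then y else α y := by
    intro y
    rw [Perm.mul_apply]
    by_cases h1 : y = x
    · subst h1; simp
    · by_cases h2 : y = α x
      · subst h2; simp [hh]
      · rw [swap_apply_of_ne_of_ne]
        · simp [h1, h2]
        · intro e; apply h2; rw [← e, hh]
        · intro e; exact h1 (α.injective e)
  constructor
  · ext y
    rw [Perm.mul_apply, val y]
    split_ifs with h1
    · rw [val y, if_pos h1]; rfl
    · rw [val, if_neg, hh]; rfl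
      push Not at h1 ⊢
      exact ⟨fun e => h1.2 (by rw [← e, hh]), fun e => h1.1 (α.injective e)⟩
  · ext y
    simp only [Perm.mem_support, mem_erase, val]
    split_ifs with h1
    · simp; tauto
    · push Not at h1; simp [h1]

lemma card_support_erase {α : Perm X} (h : α * α = 1) {x : X} (hx : α x ≠ x) :
    ((α.support.erase x).erase (α x)).card + 2 = α.support.card := by
  have hh : ∀ y, α (α y) = y := fun y => by rw [← Perm.mul_apply, h]; rfl
  have h1 : x ∈ α.support := by simpa using hx
  have h2 : α x ∈ α.support.erase x := by simp [hx]
  have := card_erase_add_one h1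
  have := card_erase_add_one h2
  omega

lemma triangle (n : ℕ) : ∀ (π α : Perm X), α * α = 1 → α.support.card = n →
    2 * cycleCount (π * α) ≤ 2 * cycleCount π + n := by
  induction n using Nat.strong_induction_on with
  | _ n ih =>
    intro π α h hn
    by_cases h1 : α = 1
    · subst h1; simp
    · obtain ⟨x, hx⟩ : ∃ x, α x ≠ x := by
        by_contra hc; push Not at hc; exact h1 (Equiv.ext hc)
      obtain ⟨i1, i2⟩ := support_swap_mul h hx
      have hc := card_support_erase h hx
      have := ih (n-2) (by omega) (π * swap x (α x)) (swap x (α x) * α) i1 (by rw [i2]; omega)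
      rw [mul_assoc, ← mul_assoc (swap x (α x)), swap_mul_self, one_mul] at this
      by_cases hs : π.SameCycle x (α x)
      · have := cycleCount_split hs (Ne.symm hx); omega
      · have := cycleCount_merge hs; omega

/-- Matchings of `T` of genus zero relative to `π`. -/
noncomputable def planarSet (π : Perm X) (T : Finset X) : Finset (Perm X) :=
  open Classical in
  univ.filter fun α => α * α = 1 ∧ α.support = T ∧
    2 * cycleCount (π * α) = 2 * cycleCount π + T.card

lemma mem_planarSet {π : Perm X} {T : Finset X} {α : Perm X} : α ∈ planarSet π T ↔
    α * α = 1 ∧ α.support = T ∧ 2 * cycleCount (π * α) = 2 * cycleCount π + T.card := by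
  simp [planarSet]

lemma swap_mul_facts {β : Perm X} (h : β * β = 1) {x j : X} (hx : β x = x) (hj : β j = j)
    (hxj : x ≠ j) : (swap x j * β) * (swap x j * β) = 1 ∧ (swap x j * β) x = j ∧
    (swap x j * β).support = insert x (insert j β.support) := by
  have hh : ∀ y, β (β y) = y := fun y => by rw [← Perm.mul_apply, h]; rfl
  have hd : Perm.Disjoint (swap x j) β := by
    intro y
    by_cases h1 : y = x
    · right; rw [h1, hx]
    · by_cases h2 : y = j
      · right; rw [h2, hj]
      · left; exact swap_apply_of_ne_of_ne h1 h2
  refine ⟨?_, by simp [hx], ?_⟩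
  · rw [mul_assoc, ← mul_assoc β, ← hd.commute.eq, mul_assoc, h, mul_one, swap_mul_self]
  · rw [hd.support_mul, Perm.support_swap hxj]
    ext; simp

open Classical in
lemma planarSet_rec (π : Perm X) (T : Finset X) {x : X} (hx : x ∈ T) :
    (planarSet π T).card = ∑ j ∈ (T.erase x).filter (fun j => π.SameCycle x j),
      (planarSet (π * swap x j) ((T.erase x).erase j)).card := by
  rw [card_eq_sum_card_fiberwise (f := fun α : Perm X => α x)
    (t := (T.erase x).filter (fun j => π.SameCycle x j))]
  · refine sum_congr rfl ?_
    intro j hj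
    simp only [mem_filter, mem_erase] at hj
    obtain ⟨⟨hjx, hjT⟩, hs⟩ := hj
    have hsp := cycleCount_split hs (Ne.symm hjx)
    have hcard : ((T.erase x).erase j).card + 2 = T.card := by
      have := card_erase_add_one hx
      have := card_erase_add_one (show j ∈ T.erase x by simp [hjx, hjT])
      omega
    refine card_bij' (fun α _ => swap x j * α) (fun α _ => swap x j * α) ?_ ?_ ?_ ?_
    · intro α hα
      simp only [mem_filter, mem_planarSet] at hα ⊢
      obtain ⟨⟨h1, rfl, h3⟩, rfl⟩ := hα
      obtain ⟨i1, i2⟩ := support_swap_mul h1 hjx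
      refine ⟨i1, i2, ?_⟩
      rw [mul_assoc, ← mul_assoc (swap x (α x)), swap_mul_self, one_mul]
      omega
    · intro β hβ
      simp only [mem_filter, mem_planarSet] at hβ ⊢
      obtain ⟨h1, h2, h3⟩ := hβ
      have e1 : β x = x := by
        rw [← Perm.notMem_support, h2]; simp
      have e2 : β j = j := by
        rw [← Perm.notMem_support, h2]; simp
      obtain ⟨i1, i2, i3⟩ := swap_mul_facts h1 e1 e2 (Ne.symm hjx)
      refine ⟨⟨i1, ?_, ?_⟩, i2⟩
      · rw [i3, h2, insert_erase (by simp [hjx, hjT]), insert_erase hx]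
      · rw [← mul_assoc]; omega
    · intro α _; simp [← mul_assoc]
    · intro α _; simp [← mul_assoc]
  · intro α hα
    have hα' := mem_planarSet.1 (by simpa using hα)
    obtain ⟨h1, rfl, h3⟩ := hα'
    have hx' : α x ≠ x := by simpa using hx
    simp only [coe_filter, mem_erase, Set.mem_ofPred_eq]
    refine ⟨⟨hx', by simpa using hx'⟩, ?_⟩
    by_contra hs
    have hm := cycleCount_merge hs
    obtain ⟨i1, i2⟩ := support_swap_mul h1 hx'
    have hc := card_support_erase h1 hx'
    have := triangle _ (π * swap x (α x)) (swap x (α x) * α) i1 rfl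
    rw [mul_assoc, ← mul_assoc (swap x (α x)), swap_mul_self, one_mul, i2] at this
    omega

end aux

/-- Catalan numbers at half-integers. -/
def halfCat (t : ℕ) : ℕ := if Even t then catalan (t / 2) else 0

lemma halfCat_even (u : ℕ) : halfCat (2 * u) = catalan u := by
  unfold halfCat; rw [if_pos (by simp)]; congr 1; omega

lemma halfCat_odd (u : ℕ) : halfCat (2 * u + 1) = 0 := by
  unfold halfCat; rw [if_neg (by simp)]

lemma sum_even (f : ℕ → ℕ) (hf : ∀ i, f (2 * i + 1) = 0) (u : ℕ) :
    ∑ r ∈ range (2 * u + 1), f r = ∑ r ∈ range (u + 1), f (2 * r) := by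
  induction u with
  | zero => simp
  | succ u ih =>
    rw [show 2 * (u + 1) + 1 = (2 * u + 1) + 1 + 1 by ring, sum_range_succ, sum_range_succ, ih, hf,
      sum_range_succ _ (u+1)]
    ring_nf

lemma halfCat_rec (s : ℕ) :
    ∑ r ∈ range s, halfCat r * halfCat (s - 1 - r) = halfCat (s + 1) := by
  obtain ⟨u, rfl | rfl⟩ : ∃ u, s = 2 * u ∨ s = 2 * u + 1 := ⟨s / 2, by omega⟩
  · rw [halfCat_odd]
    apply sum_eq_zero
    intro r hr
    rw [mem_range] at hr
    obtain ⟨v, rfl | rfl⟩ : ∃ v, r = 2 * v ∨ r = 2 * v + 1 := ⟨r / 2, by omega⟩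
    · rw [show 2 * u - 1 - 2 * v = 2 * (u - 1 - v) + 1 by omega, halfCat_odd, mul_zero]
    · rw [halfCat_odd, zero_mul]
  · rw [show 2 * u + 1 + 1 = 2 * (u + 1) by ring, halfCat_even, catalan_succ,
      sum_even _ (by intro i; rw [halfCat_odd, zero_mul]), ← Fin.sum_univ_eq_sum_range
      (fun r => halfCat (2 * r) * halfCat (2 * u + 1 - 1 - 2 * r))]
    refine sum_congr rfl ?_
    intro i _
    rw [show 2 * u + 1 - 1 - 2 * (i : ℕ) = 2 * (u - i) by omega, halfCat_even, halfCat_even]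

lemma sum_rank (g : ℕ → ℕ) (S : Finset ℕ) :
    ∑ k ∈ S, g (S.filter (· < k)).card = ∑ r ∈ range S.card, g r := by
  induction S using Finset.induction_on_max with
  | empty => simp
  | insert m S hm ih =>
    have hmS : m ∉ S := fun h => lt_irrefl _ (hm m h)
    rw [sum_insert hmS, card_insert_of_notMem hmS, sum_range_succ, ← ih, add_comm]
    congr 1
    · refine sum_congr rfl ?_
      intro k hk
      rw [filter_insert, if_neg (by have := hm k hk; omega)]
    · rw [filter_insert, if_neg (lt_irrefl _), filter_true_of_mem hm]

section main
variable {X : Type} [Fintype X] [DecidableEq X]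

lemma splitCol_eq_N {π : Perm X} {κ : X → ℕ} {N : ℕ} (hN : ∀ x, κ x < N) {a : X} {k : ℕ} (y : X) :
    splitCol π κ N a k y = N ↔ ∃ i, 0 < i ∧ i ≤ k ∧ (π ^ i) a = y := by
  unfold splitCol
  split_ifs with h
  · simp [h]
  · simp [h, (hN y).ne]

lemma splitCol_eq_of_lt {π : Perm X} {κ : X → ℕ} {N : ℕ} {a : X} {k : ℕ} (y : X) {c : ℕ}
    (hc : c < N) :
    splitCol π κ N a k y = c ↔ κ y = c ∧ ¬ ∃ i, 0 < i ∧ i ≤ k ∧ (π ^ i) a = y := by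
  unfold splitCol
  split_ifs with h
  · simp [h, hc.ne']
  · simp [h]

open Classical in
lemma planar_count (n : ℕ) : ∀ (π : Perm X) (T : Finset X) (κ : X → ℕ) (N : ℕ), T.card = n →
    Classifies π κ → (∀ x, κ x < N) →
    (planarSet π T).card = ∏ c ∈ range N, halfCat (T.filter (fun y => κ y = c)).card := by
  induction n using Nat.strong_induction_on with
  | _ n ih =>
    intro π T κ N hT hκ hN
    rcases T.eq_empty_or_nonempty with rfl | ⟨x, hx⟩
    · have h1 : planarSet π (∅ : Finset X) = {1} := by
        ext α
        rw [mem_planarSet, mem_singleton, Perm.support_eq_empty_iff]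
        constructor
        · exact fun h => h.2.1
        · rintro rfl; simp
      have h0 : halfCat 0 = 1 := by simp [halfCat]
      rw [h1]; simp [h0]
    · rw [planarSet_rec π T hx]
      set p := Function.minimalPeriod π x with hp
      have hxp : (π ^ p) x = x := pow_minPer π x
      have hp0 : 0 < p := minPer_pos π x
      set S := (Ioo 0 p).filter (fun i => (π ^ i) x ∈ T) with hS
      have memS : ∀ i, i ∈ S ↔ (0 < i ∧ i < p) ∧ (π ^ i) x ∈ T := by
        intro i; simp [hS]
      have inj : ∀ i ∈ S, ∀ j ∈ S, (π ^ i) x = (π ^ j) x → i = j := by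
        intro i hi j hj e
        rw [memS] at hi hj
        exact pow_inj hi.1.1 hj.1.1 hi.1.2.le hj.1.2.le e
      have nex : ∀ i, 0 < i → i < p → (π ^ i) x ≠ x := by
        intro i h1 h2 e
        have := pow_inj h1 hp0 h2.le le_rfl (e.trans hxp.symm)
        omega
      have himg : (T.erase x).filter (fun j => π.SameCycle x j) = S.image (fun i => (π ^ i) x) := by
        ext y
        simp only [mem_filter, mem_erase, mem_image, memS]
        constructor
        · rintro ⟨⟨h1, h2⟩, h3⟩
          obtain ⟨k, k1, k2, rfl⟩ := exists_idx_lt h3 (Ne.symm h1)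
          exact ⟨k, ⟨⟨k1, k2⟩, h2⟩, rfl⟩
        · rintro ⟨k, ⟨⟨k1, k2⟩, h2⟩, rfl⟩
          exact ⟨⟨nex k k1 k2, h2⟩, sameCycle_pow π x k⟩
      rw [himg, sum_image (fun i hi j hj e => inj i hi j hj e)]
      set R := ∏ c ∈ (range N).erase (κ x), halfCat (T.filter (fun y => κ y = c)).card with hR
      have hmem : κ x ∈ range N := mem_range.2 (hN x)
      have term : ∀ k ∈ S,
          (planarSet (π * swap x ((π ^ k) x)) ((T.erase x).erase ((π ^ k) x))).card
          = R * (halfCat (S.filter (· < k)).card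
            * halfCat (S.card - 1 - (S.filter (· < k)).card)) := by
        intro k hk
        obtain ⟨⟨k1, k2⟩, k3⟩ := (memS k).1 hk
        have hlt : ((T.erase x).erase ((π ^ k) x)).card < n := by
          rw [← hT]
          exact lt_of_le_of_lt (card_le_card (erase_subset _ _)) (card_erase_lt_of_mem hx)
        rw [ih _ hlt _ _ _ (N+1) rfl (classifies_split hκ hN k1 k2) (by
          intro y
          unfold splitCol
          split_ifs
          · omega
          · have := hN y; omega)]
        rw [prod_range_succ, ← mul_prod_erase (range N) _ hmem]
        have e1 : ∏ c ∈ (range N).erase (κ x), halfCat (((T.erase x).erase ((π ^ k) x)).filter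
            (fun y => splitCol π κ N x k y = c)).card = R := by
          refine prod_congr rfl ?_
          intro c hc
          rw [mem_erase, mem_range] at hc
          congr 2
          ext y
          simp only [mem_filter, mem_erase, splitCol_eq_of_lt y hc.2]
          constructor
          · rintro ⟨⟨_, _, h⟩, h', _⟩; exact ⟨h, h'⟩
          · rintro ⟨h1, h2⟩
            have hs : ∀ i : ℕ, (π ^ i) x ≠ y := by
              intro i e
              have := (hκ _ _).1 (sameCycle_pow π x i)
              rw [e, h2] at this
              exact hc.1 this.symm
            refine ⟨⟨(hs k).symm, ?_, h1⟩, h2, ?_⟩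
            · have := hs 0
              simpa using this.symm
            · rintro ⟨i, _, _, e⟩; exact hs i e
        have e2 : (((T.erase x).erase ((π ^ k) x)).filter
            (fun y => splitCol π κ N x k y = N)).card = (S.filter (· < k)).card := by
          rw [← card_image_of_injOn (s := S.filter (· < k)) (f := fun i => (π ^ i) x)
            (fun i hi j hj e => inj i (mem_filter.1 hi).1 j (mem_filter.1 hj).1 e)]
          congr 1
          ext y
          simp only [mem_filter, mem_erase, splitCol_eq_N hN, mem_image, memS]
          constructor
          · rintro ⟨⟨h1, h2, h3⟩, i, i1, i2, rfl⟩
            refine ⟨i, ⟨⟨⟨i1, by omega⟩, h3⟩, lt_of_le_of_ne i2 ?_⟩, rfl⟩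
            rintro rfl; exact h1 rfl
          · rintro ⟨i, ⟨⟨⟨i1, i2⟩, h3⟩, h4⟩, rfl⟩
            refine ⟨⟨?_, nex i i1 i2, h3⟩, i, i1, h4.le, rfl⟩
            intro e
            have := pow_inj i1 k1 i2.le k2.le e
            omega
        have e3 : (((T.erase x).erase ((π ^ k) x)).filter
            (fun y => splitCol π κ N x k y = κ x)).card = (S.filter (k < ·)).card := by
          rw [← card_image_of_injOn (s := S.filter (k < ·)) (f := fun i => (π ^ i) x)
            (fun i hi j hj e => inj i (mem_filter.1 hi).1 j (mem_filter.1 hj).1 e)]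
          congr 1
          ext y
          simp only [mem_filter, mem_erase, splitCol_eq_of_lt y (hN x), mem_image, memS]
          constructor
          · rintro ⟨⟨h1, h2, h3⟩, h4, h5⟩
            obtain ⟨i, i1, i2, rfl⟩ := exists_idx_lt ((hκ _ _).2 h4.symm) (Ne.symm h2)
            refine ⟨i, ⟨⟨⟨i1, i2⟩, h3⟩, ?_⟩, rfl⟩
            by_contra hc
            exact h5 ⟨i, i1, by omega, rfl⟩
          · rintro ⟨i, ⟨⟨⟨i1, i2⟩, h3⟩, h4⟩, rfl⟩
            refine ⟨⟨?_, nex i i1 i2, h3⟩, ((hκ _ _).1 (sameCycle_pow π x i)).symm, ?_⟩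
            · intro e
              have := pow_inj i1 k1 i2.le k2.le e
              omega
            · rintro ⟨j, j1, j2, e⟩
              have := pow_inj j1 i1 (by omega) i2.le e
              omega
        have e4 : (S.filter (k < ·)).card = S.card - 1 - (S.filter (· < k)).card := by
          have h1 := card_filter_add_card_filter_not (s := S.erase k) (fun i => i < k)
          rw [card_erase_of_mem hk] at h1
          have h2 : (S.erase k).filter (fun i => i < k) = S.filter (· < k) := by
            ext i; simp only [mem_filter, mem_erase]; constructor
            · rintro ⟨⟨_, h⟩, h'⟩; exact ⟨h, h'⟩
            · rintro ⟨h, h'⟩; exact ⟨⟨by omega, h⟩, h'⟩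
          have h3 : (S.erase k).filter (fun i => ¬ i < k) = S.filter (k < ·) := by
            ext i; simp only [mem_filter, mem_erase]; constructor
            · rintro ⟨⟨_, h⟩, h'⟩; exact ⟨h, by omega⟩
            · rintro ⟨h, h'⟩; exact ⟨⟨by omega, h⟩, by omega⟩
          rw [h2, h3] at h1
          omega
        rw [e1, e2, e3, e4]
        ring
      rw [sum_congr rfl term, ← mul_sum,
        sum_rank (fun r => halfCat r * halfCat (S.card - 1 - r)) S, halfCat_rec,
        ← mul_prod_erase (range N) _ hmem, mul_comm]
      congr 2
      have e5 : T.filter (fun y => κ y = κ x) = insert x (S.image (fun i => (π ^ i) x)) := by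
        rw [← himg]
        ext y
        simp only [mem_filter, mem_insert, mem_erase]
        rw [hκ x y]
        constructor
        · rintro ⟨h1, h2⟩
          by_cases hy : y = x
          · exact Or.inl hy
          · exact Or.inr ⟨⟨hy, h1⟩, h2.symm⟩
        · rintro (rfl | ⟨⟨_, h1⟩, h2⟩)
          · exact ⟨hx, rfl⟩
          · exact ⟨h1, h2.symm⟩
      rw [e5, card_insert_of_notMem, card_image_of_injOn (fun i hi j hj e => inj i hi j hj e)]
      rw [← himg]; simp

end main

/-- The number of arrowed one-vertex planar graphs of degree `2m` equals the `m`-th Catalan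
number: for `m ≥ 1`, the number of fixed-point-free involutions `α` of `ℤ/2mℤ` (encoded as
`Fin (2*m)`) such that the permutation `x ↦ α(x) + 1` (i.e. `finRotate (2*m) * α`) has
exactly `m + 1` cycles is `catalan m`. -/
theorem one_vertex_planar_graph_count (m : ℕ) (hm : 1 ≤ m) :
    Nat.card {α : Equiv.Perm (Fin (2 * m)) //
      (∀ x, α x ≠ x) ∧ α * α = 1 ∧ cycleCount (finRotate (2 * m) * α) = m + 1}
      = catalan m := by
  classical
  have hrot : ∀ x y, (finRotate (2 * m)).SameCycle x y := by
    obtain ⟨q, hq⟩ : ∃ q, 2 * m = q + 2 := ⟨2 * m - 2, by omega⟩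
    rw [hq]
    intro x y
    have hc := isCycle_finRotate (n := q)
    have hsupp := support_finRotate (n := q)
    refine hc.sameCycle ?_ ?_
    · rw [← Perm.mem_support, hsupp]; simp
    · rw [← Perm.mem_support, hsupp]; simp
  have hcl : Classifies (finRotate (2 * m)) (fun _ => 0) := fun x y => by simp [hrot x y]
  have hcc : cycleCount (finRotate (2 * m)) = 1 := by
    rw [cycleCount_eq_image hcl, image_const ⟨⟨0, by omega⟩, mem_univ _⟩, card_singleton]
  have key := planar_count _ (finRotate (2 * m)) univ (fun _ => 0) 1 rfl hcl (by simp)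
  rw [prod_range_one, filter_true_of_mem (by simp), card_univ, Fintype.card_fin,
    halfCat_even] at key
  rw [← key, ← Nat.card_eq_finsetCard]
  refine Nat.card_congr (Equiv.subtypeEquivRight ?_)
  intro α
  rw [mem_planarSet, hcc, card_univ, Fintype.card_fin]
  have : α.support = univ ↔ ∀ x, α x ≠ x := by
    simp [Finset.ext_iff]
  rw [this]
  constructor
  · rintro ⟨h1, h2, h3⟩; exact ⟨h2, h1, by omega⟩
  · rintro ⟨h1, h2, h3⟩; exact ⟨h2, h1, by omega⟩
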